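/- arXiv:1311.4119 — 5 statements merged into one kernel-verified Lean document; each statement's English description precedes it below -/
import Mathlib

section
/- Let ρ_max, V_max, τ, η₀, Θ₀ > 0 and V_g, Q_g be real constants, and set the dimensionless parameters θ₀ = Θ₀/V_max², λ = V_max/η₀, μ = 1/(ρ_max η₀ τ), v_g = V_g/V_max, q_g = Q_g/(ρ_max V_max). Let w : ℝ → ℝ be smooth and define V_e(ρ) = V_max · w(ρ/ρ_max). Suppose v : ℝ → ℝ is twice continuously differentiable, v(z) + v_g > 0 for all z, and v satisfies the ordinary differential equation v''(z) = λ q_g (1 − θ₀/(v(z)+v_g)²) v'(z) − μ q_g (w(q_g/(v(z)+v_g)) − v(z))/(v(z)+v_g). Define V(x,t) = V_max · v(ρ_max(x + V_g t)) and ρ(x,t) = ρ_max · q_g/(v(ρ_max(x + V_g t)) + v_g). Then (ρ, V) satisfies the continuity equation ∂ρ/∂t + ∂(ρV)/∂x = 0 and the momentum equation ρ(∂V/∂t + V ∂V/∂x) = −∂P/∂x + ρ(V_e(ρ) − V)/τ, where P(x,t) = ρ(x,t) Θ₀ − η₀ ∂V/∂x(x,t). -/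
/-- Spatial and temporal derivatives of a profile along the traveling-wave phase `k (x + c t)`. -/
theorem HasDerivAt.comp_wave_phase {f : ℝ → ℝ} {f' k c x t : ℝ}
    (hf : HasDerivAt f f' (k * (x + c * t))) :
    HasDerivAt (fun x' => f (k * (x' + c * t))) (f' * k) x ∧
      HasDerivAt (fun t' => f (k * (x + c * t'))) (f' * (k * c)) t := by
  constructor
  · refine hf.comp x (h := fun x' => k * (x' + c * t)) ?_
    simpa using ((hasDerivAt_id x).add_const (c * t)).const_mul k
  · refine hf.comp t (h := fun t' => k * (x + c * t')) ?_
    simpa using (((hasDerivAt_id t).const_mul c).const_add x).const_mul k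


/-- If the dimensionless velocity profile `v` satisfies the traveling-wave ODE of the
Kerner–Konhäuser model, then the fields `V(x,t) = V_max · v(ρ_max(x + V_g t))` and
`ρ(x,t) = ρ_max · q_g/(v(ρ_max(x + V_g t)) + v_g)` satisfy the continuity equation and
the momentum equation with pressure `P = ρΘ₀ − η₀ ∂V/∂x`. -/
theorem traveling_wave_solves_KK_PDE
    (ρmax Vmax τ η₀ Θ₀ : ℝ)
    (hρmax : 0 < ρmax) (hVmax : 0 < Vmax) (hτ : 0 < τ) (hη₀ : 0 < η₀) (hΘ₀ : 0 < Θ₀)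
    (Vg Qg : ℝ)
    (θ₀ lam μ vg qg : ℝ)
    (hθ₀ : θ₀ = Θ₀ / Vmax ^ 2) (hlam : lam = Vmax / η₀) (hμ : μ = 1 / (ρmax * η₀ * τ))
    (hvg : vg = Vg / Vmax) (hqg : qg = Qg / (ρmax * Vmax))
    (w : ℝ → ℝ) (hw : ContDiff ℝ (⊤ : ℕ∞) w)
    (Ve : ℝ → ℝ) (hVe : ∀ ρ : ℝ, Ve ρ = Vmax * w (ρ / ρmax))
    (v : ℝ → ℝ) (hv : ContDiff ℝ 2 v)
    (hpos : ∀ z : ℝ, 0 < v z + vg)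
    (hode : ∀ z : ℝ,
      deriv (deriv v) z
        = lam * qg * (1 - θ₀ / (v z + vg) ^ 2) * deriv v z
          - μ * qg * (w (qg / (v z + vg)) - v z) / (v z + vg))
    (V ρ P : ℝ → ℝ → ℝ)
    (hV : ∀ x t : ℝ, V x t = Vmax * v (ρmax * (x + Vg * t)))
    (hρ : ∀ x t : ℝ, ρ x t = ρmax * qg / (v (ρmax * (x + Vg * t)) + vg))
    (hP : ∀ x t : ℝ, P x t = ρ x t * Θ₀ - η₀ * deriv (fun x' : ℝ => V x' t) x) :
    (∀ x t : ℝ,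
      deriv (fun t' : ℝ => ρ x t') t + deriv (fun x' : ℝ => ρ x' t * V x' t) x = 0)
    ∧
    (∀ x t : ℝ,
      ρ x t * (deriv (fun t' : ℝ => V x t') t + V x t * deriv (fun x' : ℝ => V x' t) x)
        = - deriv (fun x' : ℝ => P x' t) x + ρ x t * (Ve (ρ x t) - V x t) / τ) := by
  have hv1 (z : ℝ) : HasDerivAt v (deriv v z) z :=
    (hv.differentiable (by norm_num) z).hasDerivAt
  have hv2 (z : ℝ) : HasDerivAt (deriv v) (deriv (deriv v) z) z :=
    (hv.differentiable_deriv_two z).hasDerivAt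
  have hVx (x t : ℝ) : HasDerivAt (fun x' => V x' t)
      (Vmax * (deriv v (ρmax * (x + Vg * t)) * ρmax)) x := by
    simpa only [hV] using (hv1 _).comp_wave_phase.1.const_mul Vmax
  have hVt (x t : ℝ) : HasDerivAt (fun t' => V x t')
      (Vmax * (deriv v (ρmax * (x + Vg * t)) * (ρmax * Vg))) t := by
    simpa only [hV] using (hv1 _).comp_wave_phase.2.const_mul Vmax
  have hprofile (z : ℝ) : HasDerivAt (fun z => ρmax * qg / (v z + vg))
      (-(ρmax * qg * deriv v z) / (v z + vg) ^ 2) z := by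
    refine ((hasDerivAt_const z (ρmax * qg)).fun_div
      ((hv1 z).add_const vg) (hpos z).ne').congr_deriv ?_
    ring
  have hρx (x t : ℝ) : HasDerivAt (fun x' => ρ x' t)
      (-(ρmax * qg * deriv v (ρmax * (x + Vg * t))) /
        (v (ρmax * (x + Vg * t)) + vg) ^ 2 * ρmax) x := by
    simpa only [hρ] using (hprofile (ρmax * (x + Vg * t))).comp_wave_phase.1
  have hρt (x t : ℝ) : HasDerivAt (fun t' => ρ x t')
      (-(ρmax * qg * deriv v (ρmax * (x + Vg * t))) /
        (v (ρmax * (x + Vg * t)) + vg) ^ 2 * (ρmax * Vg)) t := by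
    simpa only [hρ] using (hprofile (ρmax * (x + Vg * t))).comp_wave_phase.2
  have hPx (x t : ℝ) : HasDerivAt (fun x' => P x' t)
      (-(ρmax * qg * deriv v (ρmax * (x + Vg * t))) /
        (v (ρmax * (x + Vg * t)) + vg) ^ 2 * ρmax * Θ₀ -
        η₀ * (Vmax * (deriv (deriv v) (ρmax * (x + Vg * t)) * ρmax * ρmax))) x := by
    simp only [hP, (hVx _ _).deriv]
    exact ((hρx x t).mul_const Θ₀).sub
      (((hv2 (ρmax * (x + Vg * t))).comp_wave_phase.1.mul_const ρmax
        |>.const_mul Vmax).const_mul η₀)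
  have hVg : Vg = Vmax * vg := by
    rw [hvg]
    field_simp
  refine ⟨fun x t => ?_, fun x t => ?_⟩
  · have hu := (hpos (ρmax * (x + Vg * t))).ne'
    rw [(hρt x t).deriv, ((hρx x t).fun_mul (hVx x t)).deriv, hρ, hV]
    generalize deriv v (ρmax * (x + Vg * t)) = v' at hu ⊢
    generalize v (ρmax * (x + Vg * t)) = v₀ at hu ⊢
    rw [hVg]
    field_simp
    ring
  · have hu := (hpos (ρmax * (x + Vg * t))).ne'
    have hw_arg : ρmax * qg / (v (ρmax * (x + Vg * t)) + vg) / ρmax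
        = qg / (v (ρmax * (x + Vg * t)) + vg) := by
      field_simp
    rw [(hVt x t).deriv, (hVx x t).deriv, (hPx x t).deriv, hVe, hρ, hV, hode, hw_arg]
    generalize w (qg / (v (ρmax * (x + Vg * t)) + vg)) = w₀
    generalize deriv v (ρmax * (x + Vg * t)) = v' at hu ⊢
    generalize v (ρmax * (x + Vg * t)) = v₀ at hu ⊢
    rw [hVg, hθ₀, hlam, hμ]
    field_simp
    ring
end

section
/- Let w : ℝ → ℝ be the dimensionless Kerner–Konhäuser fundamental diagram, w(r) = 1/(1 + exp((r − 0.25)/0.06)) − 3.72·10⁻⁶. Then there exist parameter values q_g > 0 and v_g ∈ ℝ and three distinct real numbers v₁ < v₂ < v₃ such that vᵢ + v_g > 0 and w(q_g/(vᵢ + v_g)) = vᵢ for i = 1, 2, 3. -/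
/-- For the dimensionless Kerner–Konhäuser fundamental diagram
`w(r) = 1/(1 + exp((r − 0.25)/0.06)) − 3.72·10⁻⁶`, there exist parameters `q_g > 0`,
`v_g ∈ ℝ`, and three distinct values `v₁ < v₂ < v₃` with `vᵢ + v_g > 0` and
`w(q_g/(vᵢ + v_g)) = vᵢ` for `i = 1,2,3` (three critical points of the traveling-wave
system). -/
theorem KK_three_critical_points
    (w : ℝ → ℝ)
    (hw : ∀ r : ℝ, w r = 1 / (1 + Real.exp ((r - 0.25) / 0.06)) - 3.72e-6) :
    ∃ qg vg v₁ v₂ v₃ : ℝ,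
      0 < qg ∧
      v₁ < v₂ ∧ v₂ < v₃ ∧
      0 < v₁ + vg ∧ 0 < v₂ + vg ∧ 0 < v₃ + vg ∧
      w (qg / (v₁ + vg)) = v₁ ∧
      w (qg / (v₂ + vg)) = v₂ ∧
      w (qg / (v₃ + vg)) = v₃ := by
  have hcont : ContinuousOn (fun v : ℝ => w (0.15 / (v + 0.1)) - v) (Set.Ioi (-0.1)) := by
    have hne : ∀ v ∈ Set.Ioi (-0.1 : ℝ), v + 0.1 ≠ 0 := fun v hv => by
      have : -0.1 < v := hv
      linarith
    simp only [hw]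
    refine ContinuousOn.sub (ContinuousOn.sub (continuousOn_const.div ?_ fun v _ => by positivity)
      continuousOn_const) continuousOn_id
    exact continuousOn_const.add (Real.continuous_exp.comp_continuousOn
      (((continuousOn_const.div (by fun_prop) hne).sub continuousOn_const).div_const _))
  have hpos₀ : 0 < w (0.15 / (-0.05 + 0.1)) - (-0.05) := by
    rw [hw]
    have : 0 < 1 / (1 + Real.exp ((0.15 / (-0.05 + 0.1) - 0.25) / 0.06)) := by positivity
    linarith
  have hneg₁ : w (0.15 / (0.4 + 0.1)) - 0.4 < 0 := by
    rw [hw]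
    have he := Real.add_one_le_exp (((0.15 : ℝ) / (0.4 + 0.1) - 0.25) / 0.06)
    have : 1 / (1 + Real.exp (((0.15 : ℝ) / (0.4 + 0.1) - 0.25) / 0.06)) < 0.4 := by
      rw [div_lt_iff₀ (by positivity)]
      norm_num at he ⊢
      linarith
    linarith
  have hpos₂ : 0 < w (0.15 / (0.6 + 0.1)) - 0.6 := by
    rw [hw]
    have he := Real.add_one_le_exp (-(((0.15 : ℝ) / (0.6 + 0.1) - 0.25) / 0.06))
    have hx := Real.exp_pos (((0.15 : ℝ) / (0.6 + 0.1) - 0.25) / 0.06)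
    have hmul : Real.exp (((0.15 : ℝ) / (0.6 + 0.1) - 0.25) / 0.06) *
        Real.exp (-(((0.15 : ℝ) / (0.6 + 0.1) - 0.25) / 0.06)) = 1 := by
      rw [← Real.exp_add, add_neg_cancel, Real.exp_zero]
    have : 0.61 < 1 / (1 + Real.exp (((0.15 : ℝ) / (0.6 + 0.1) - 0.25) / 0.06)) := by
      rw [lt_div_iff₀ (by positivity)]
      have := mul_le_mul_of_nonneg_left he hx.le
      rw [hmul] at this
      norm_num at this ⊢
      linarith
    linarith
  have hneg₃ : w (0.15 / (1 + 0.1)) - 1 < 0 := by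
    rw [hw]
    have : 1 / (1 + Real.exp (((0.15 : ℝ) / (1 + 0.1) - 0.25) / 0.06)) < 1 := by
      rw [div_lt_one (by positivity)]
      linarith [Real.exp_pos (((0.15 : ℝ) / (1 + 0.1) - 0.25) / 0.06)]
    linarith
  have hsub : ∀ {a b : ℝ}, -0.1 < a → Set.Icc a b ⊆ Set.Ioi (-0.1) :=
    fun ha _ hx => lt_of_lt_of_le ha hx.1
  obtain ⟨v₁, ⟨h₁, h₁'⟩, e₁⟩ := intermediate_value_Ioo' (by norm_num)
    (hcont.mono (hsub (a := -0.05) (b := 0.4) (by norm_num))) ⟨hneg₁, hpos₀⟩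
  obtain ⟨v₂, ⟨h₂, h₂'⟩, e₂⟩ := intermediate_value_Ioo (by norm_num)
    (hcont.mono (hsub (a := 0.4) (b := 0.6) (by norm_num))) ⟨hneg₁, hpos₂⟩
  obtain ⟨v₃, ⟨h₃, h₃'⟩, e₃⟩ := intermediate_value_Ioo' (by norm_num)
    (hcont.mono (hsub (a := 0.6) (b := 1) (by norm_num))) ⟨hneg₃, hpos₂⟩
  exact ⟨0.15, 0.1, v₁, v₂, v₃, by norm_num, by linarith, by linarith, by linarith, by linarith,
    by linarith, sub_eq_zero.mp e₁, sub_eq_zero.mp e₂, sub_eq_zero.mp e₃⟩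
end

section
/- Let λ, μ, q_g > 0 and v_c + v_g > 0 be real numbers, set h = 1/(v_c + v_g), let d₁, d₂, d₃ ∈ ℝ with d₁ > 1, and let ω₀ > 0 satisfy ω₀² = μ q_g (d₁ − 1) h. Define the complex numbers g₂₀ = 2λ q_g h − i (2ω₀² − μ q_g d₂)/(2ω₀(v_c+v_g)), g₁₁ = − i (2ω₀² − μ q_g d₂)/(2ω₀(v_c+v_g)), and g₂₁ = (i/(2ω₀(v_c+v_g)))·(3μ q_g d₂/(v_c+v_g) − μ q_g d₃ − 6ω₀²/(v_c+v_g)) − 3λ q_g h². Then (1/(2ω₀²)) · Re( i g₂₀ g₁₁ + ω₀ g₂₁ ) = −(λ μ q_g² /(2 ω₀³ (v_c+v_g)²)) · ( (d₁ − 1)/(v_c + v_g) + d₂ ). -/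
/-- The first Lyapunov coefficient formula: with `g₂₀`, `g₁₁`, `g₂₁` as computed in the
paper's Appendix A (with `d₁ = v_e′(v_c)`, `d₂ = v_e″(v_c)`, `d₃ = v_e‴(v_c)`,
`h = 1/(v_c+v_g)` and `ω₀² = μ q_g (d₁−1) h`),
`(1/(2ω₀²)) Re(i g₂₀ g₁₁ + ω₀ g₂₁)
   = −(λμq_g²/(2ω₀³(v_c+v_g)²))·((d₁−1)/(v_c+v_g) + d₂)`. -/
theorem first_lyapunov_coefficient_formula
    (lam μ qg vc vg h ω₀ d₁ d₂ d₃ : ℝ)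
    (hlam : 0 < lam) (hμ : 0 < μ) (hqg : 0 < qg)
    (hpos : 0 < vc + vg)
    (hh : h = 1 / (vc + vg))
    (hd₁ : 1 < d₁)
    (hω₀ : 0 < ω₀)
    (hω₀sq : ω₀ ^ 2 = μ * qg * (d₁ - 1) * h)
    (g20 g11 g21 : ℂ)
    (hg20 : g20 = (2 * lam * qg * h : ℝ)
        - Complex.I * (((2 * ω₀ ^ 2 - μ * qg * d₂) / (2 * ω₀ * (vc + vg)) : ℝ)))
    (hg11 : g11 = - Complex.I * (((2 * ω₀ ^ 2 - μ * qg * d₂) / (2 * ω₀ * (vc + vg)) : ℝ)))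
    (hg21 : g21 = Complex.I / ((2 * ω₀ * (vc + vg) : ℝ))
          * ((3 * μ * qg * d₂ / (vc + vg) - μ * qg * d₃ - 6 * ω₀ ^ 2 / (vc + vg) : ℝ))
        - (3 * lam * qg * h ^ 2 : ℝ)) :
    (1 / (2 * ω₀ ^ 2)) * (Complex.I * g20 * g11 + (ω₀ : ℂ) * g21).re
      = -(lam * μ * qg ^ 2 / (2 * ω₀ ^ 3 * (vc + vg) ^ 2))
          * ((d₁ - 1) / (vc + vg) + d₂) := by
  have hre : (Complex.I * g20 * g11 + (ω₀ : ℂ) * g21).re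
      = 2 * lam * qg * h * ((2 * ω₀ ^ 2 - μ * qg * d₂) / (2 * ω₀ * (vc + vg)))
        - ω₀ * (3 * lam * qg * h ^ 2) := by
    have hI (a b : ℝ) : Complex.I / (a : ℂ) * (b : ℂ) = Complex.I * ((b / a : ℝ) : ℂ) := by
      push_cast
      ring
    rw [hg20, hg11, hg21, hI]
    simp only [Complex.add_re, Complex.sub_re, Complex.sub_im, Complex.mul_re, Complex.mul_im,
      Complex.neg_re, Complex.neg_im, Complex.I_re, Complex.I_im, Complex.ofReal_re,
      Complex.ofReal_im]
    ring
  have hd : (d₁ - 1) / (vc + vg) = ω₀ ^ 2 / (μ * qg) := by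
    rw [hω₀sq, hh]
    field_simp
  rw [hre, hd, hh]
  field_simp
  ring
end

section
/- Let g : ℝ → ℝ be four times continuously differentiable, let λ, μ, q_g > 0, and let κ : J → ℝ be a differentiable function on an open interval J ⊆ ℝ with κ(s) + s > 0 and g(q_g/(κ(s) + s)) = κ(s) for all s ∈ J. For s ∈ J and k = 1, 2, 3 let D_k(s) denote the k-th derivative at v = κ(s) of the map v ↦ g(q_g/(v + s)), and assume D₁(s) > 1 for all s ∈ J. Define ω₀(s) = sqrt( μ q_g (D₁(s) − 1)/(κ(s) + s) ) and ℓ₁(s) = −( λ μ q_g² /( 2 ω₀(s)³ (κ(s)+s)² ) ) · ( (D₁(s) − 1)/(κ(s)+s) + D₂(s) ). If at a point s₀ ∈ J one has ℓ₁(s₀) = 0 and D₃(s₀) < 0, then ℓ₁ is differentiable at s₀ and ℓ₁′(s₀) < 0. -/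
/-- The `k`-th iterated derivative of a function that is `C^n` at a point with `k < n` has the
`(k + 1)`-st iterated derivative as its derivative there. -/
theorem ContDiffAt.hasDerivAt_iteratedDeriv {𝕜 F : Type*}
    [NontriviallyNormedField 𝕜] [NormedAddCommGroup F] [NormedSpace 𝕜 F]
    {f : 𝕜 → F} {n : WithTop ℕ∞} {x : 𝕜} {k : ℕ}
    (hf : ContDiffAt 𝕜 n f x) (hk : (k : WithTop ℕ∞) < n) :
    HasDerivAt (iteratedDeriv k f) (iteratedDeriv (k + 1) f x) x := by
  rw [iteratedDeriv_succ]
  refine DifferentiableAt.hasDerivAt ?_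
  rw [← iteratedDerivWithin_univ, ← differentiableWithinAt_univ]
  exact ContDiffWithinAt.differentiableWithinAt_iteratedDerivWithin hf hk
    (by simp)

/-- Along the equilibrium branch `v_c = κ(v_g)` of the Kerner–Konhäuser traveling-wave
system, at a point where the first Lyapunov coefficient `ℓ₁` vanishes and
`v_e‴(v_c) < 0`, `ℓ₁` is differentiable with `ℓ₁′ < 0`. -/
theorem lyapunov_coefficient_decreasing_at_Bautin
    (g : ℝ → ℝ) (hg : ContDiff ℝ 4 g)
    (lam μ qg : ℝ) (hlam : 0 < lam) (hμ : 0 < μ) (hqg : 0 < qg)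
    (a b : ℝ) (κ : ℝ → ℝ)
    (hκdiff : ∀ s ∈ Set.Ioo a b, DifferentiableAt ℝ κ s)
    (hpos : ∀ s ∈ Set.Ioo a b, 0 < κ s + s)
    (hfix : ∀ s ∈ Set.Ioo a b, g (qg / (κ s + s)) = κ s)
    (D₁ D₂ D₃ : ℝ → ℝ)
    (hD₁ : ∀ s : ℝ, D₁ s = deriv (fun v : ℝ => g (qg / (v + s))) (κ s))
    (hD₂ : ∀ s : ℝ, D₂ s = iteratedDeriv 2 (fun v : ℝ => g (qg / (v + s))) (κ s))
    (hD₃ : ∀ s : ℝ, D₃ s = iteratedDeriv 3 (fun v : ℝ => g (qg / (v + s))) (κ s))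
    (hD₁gt : ∀ s ∈ Set.Ioo a b, 1 < D₁ s)
    (ω₀ ℓ₁ : ℝ → ℝ)
    (hω₀ : ∀ s : ℝ, ω₀ s = Real.sqrt (μ * qg * (D₁ s - 1) / (κ s + s)))
    (hℓ₁ : ∀ s : ℝ, ℓ₁ s = -(lam * μ * qg ^ 2 / (2 * (ω₀ s) ^ 3 * (κ s + s) ^ 2))
        * ((D₁ s - 1) / (κ s + s) + D₂ s))
    (s₀ : ℝ) (hs₀ : s₀ ∈ Set.Ioo a b)
    (hzero : ℓ₁ s₀ = 0) (hD₃neg : D₃ s₀ < 0) :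
    DifferentiableAt ℝ ℓ₁ s₀ ∧ deriv ℓ₁ s₀ < 0 := by
  set F : ℝ → ℝ := fun x => g (qg / x) with hF
  have hD₁' : D₁ = fun s => iteratedDeriv 1 F (κ s + s) := by
    funext s
    rw [hD₁, iteratedDeriv_one]
    exact deriv_comp_add_const F s (κ s)
  have hD₂' : D₂ = fun s => iteratedDeriv 2 F (κ s + s) := by
    funext s
    rw [hD₂]
    exact congrFun (iteratedDeriv_comp_add_const 2 F s) (κ s)
  have hD₃' : D₃ = fun s => iteratedDeriv 3 F (κ s + s) := by
    funext s
    rw [hD₃]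
    exact congrFun (iteratedDeriv_comp_add_const 3 F s) (κ s)
  have hx := hpos s₀ hs₀
  have hFc : ContDiffAt ℝ 4 F (κ s₀ + s₀) :=
    hg.contDiffAt.comp _ (contDiffAt_const.div contDiffAt_id hx.ne')
  have hF0 : HasDerivAt F (D₁ s₀) (κ s₀ + s₀) := by
    simpa [hD₁'] using hFc.hasDerivAt_iteratedDeriv (k := 0) (by norm_num)
  have hF1 : HasDerivAt (iteratedDeriv 1 F) (D₂ s₀) (κ s₀ + s₀) := by
    simpa only [hD₂'] using hFc.hasDerivAt_iteratedDeriv (k := 1) (by norm_num)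
  have hF2 : HasDerivAt (iteratedDeriv 2 F) (D₃ s₀) (κ s₀ + s₀) := by
    simpa only [hD₃'] using hFc.hasDerivAt_iteratedDeriv (k := 2) (by norm_num)
  obtain ⟨d, hd⟩ : ∃ d, d = deriv κ s₀ + 1 := ⟨_, rfl⟩
  have hκ : HasDerivAt κ (d - 1) s₀ := by
    simpa [hd] using (hκdiff s₀ hs₀).hasDerivAt
  have hX : HasDerivAt (fun s => κ s + s) d s₀ := by
    simpa using hκ.fun_add (hasDerivAt_id' s₀)
  have hchain : D₁ s₀ * d = d - 1 := by
    have hcomp : HasDerivAt (fun s => F (κ s + s)) (D₁ s₀ * d) s₀ := hF0.comp_of_eq s₀ hX rfl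
    refine hcomp.unique (hκ.congr_of_eventuallyEq ?_)
    filter_upwards [Ioo_mem_nhds hs₀.1 hs₀.2] with s hs using hfix s hs
  have hD1 := hD₁gt s₀ hs₀
  have hdneg : d < 0 := by nlinarith
  have hD₁d : HasDerivAt D₁ (D₂ s₀ * d) s₀ := by
    conv => arg 1; rw [hD₁']
    exact hF1.comp_of_eq s₀ hX rfl
  have hD₂d : HasDerivAt D₂ (D₃ s₀ * d) s₀ := by
    conv => arg 1; rw [hD₂']
    exact hF2.comp_of_eq s₀ hX rfl
  have hP := ((hD₁d.sub_const 1).fun_div hX hx.ne').fun_add hD₂d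
  have hrad : 0 < μ * qg * (D₁ s₀ - 1) / (κ s₀ + s₀) :=
    div_pos (mul_pos (mul_pos hμ hqg) (by linarith)) hx
  have hω : 0 < ω₀ s₀ := by rw [hω₀]; exact Real.sqrt_pos.2 hrad
  have hωd : DifferentiableAt ℝ ω₀ s₀ := by
    rw [funext hω₀]
    exact (((hD₁d.sub_const 1).differentiableAt.const_mul _).fun_div
      hX.differentiableAt hx.ne').sqrt hrad.ne'
  have hC : 0 < lam * μ * qg ^ 2 / (2 * (ω₀ s₀) ^ 3 * (κ s₀ + s₀) ^ 2) := by positivity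
  have hCd : DifferentiableAt ℝ
      (fun s => -(lam * μ * qg ^ 2 / (2 * (ω₀ s) ^ 3 * (κ s + s) ^ 2))) s₀ :=
    ((differentiableAt_const _).fun_div (((hωd.fun_pow 3).const_mul 2).fun_mul
      (hX.differentiableAt.fun_pow 2)) (by positivity)).fun_neg
  have hP0 : (D₁ s₀ - 1) / (κ s₀ + s₀) + D₂ s₀ = 0 := by
    rw [hℓ₁] at hzero
    exact (mul_eq_zero.1 hzero).resolve_left (neg_ne_zero.2 hC.ne')
  have hℓ := hCd.hasDerivAt.fun_mul hP
  rw [← funext hℓ₁, hP0] at hℓ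
  refine ⟨hℓ.differentiableAt, ?_⟩
  rw [hℓ.deriv, mul_zero, zero_add]
  refine mul_neg_of_neg_of_pos (neg_neg_of_pos hC) ?_
  have hD2 : D₂ s₀ = -((D₁ s₀ - 1) / (κ s₀ + s₀)) := by linarith
  have hslope : (D₂ s₀ * d * (κ s₀ + s₀) - (D₁ s₀ - 1) * d) / (κ s₀ + s₀) ^ 2 + D₃ s₀ * d
      = d * (D₃ s₀ - 2 * (D₁ s₀ - 1) / (κ s₀ + s₀) ^ 2) := by
    rw [hD2]
    field_simp
    ring
  rw [hslope]
  refine mul_pos_of_neg_of_neg hdneg ?_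
  have : 0 < 2 * (D₁ s₀ - 1) / (κ s₀ + s₀) ^ 2 :=
    div_pos (by linarith) (by positivity)
  linarith
end

section
/- Let g : ℝ → ℝ be three times continuously differentiable, let μ, q_g > 0 and v_g, v_c ∈ ℝ with v_c + v_g > 0, and define v_e(v) = g(q_g/(v + v_g)) and f(u) = μ q_g (v_e(u + v_c) − u − v_c)/(u + v_c + v_g) on a neighborhood of u = 0. Assume v_e(v_c) = v_c, v_e′(v_c) = 1 and v_e″(v_c) = 0. Then f(0) = 0, f′(0) = 0, f″(0) = 0, and f‴(0) = μ q_g v_e‴(v_c)/(v_c + v_g). In particular, if v_e‴(v_c) < 0 then the cubic normal-form coefficient a₃ = −f‴(0)/6 = −μ q_g v_e‴(v_c)/(6(v_c + v_g)) is strictly positive. -/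
/-- At a cusp point of the critical-point surface (`v_e(v_c) = v_c`, `v_e′(v_c) = 1`,
`v_e″(v_c) = 0`), the nonlinearity
`f(u) = μ q_g (v_e(u + v_c) − u − v_c)/(u + v_c + v_g)` vanishes to second order at
`u = 0` and `f‴(0) = μ q_g v_e‴(v_c)/(v_c + v_g)`.  In particular if `v_e‴(v_c) < 0`
the cubic normal-form coefficient `a₃ = −f‴(0)/6 = −μ q_g v_e‴(v_c)/(6(v_c + v_g))`
is strictly positive (degenerate Takens–Bogdanov of saddle type). -/
theorem degenerate_TB_cubic_coefficient
    (g : ℝ → ℝ) (hg : ContDiff ℝ 3 g)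
    (μ qg vg vc : ℝ) (hμ : 0 < μ) (hqg : 0 < qg) (hpos : 0 < vc + vg)
    (ve : ℝ → ℝ) (hve : ∀ v : ℝ, ve v = g (qg / (v + vg)))
    (f : ℝ → ℝ)
    (hf : ∀ u : ℝ, f u = μ * qg * (ve (u + vc) - u - vc) / (u + vc + vg))
    (heq : ve vc = vc)
    (hd1 : deriv ve vc = 1)
    (hd2 : iteratedDeriv 2 ve vc = 0) :
    f 0 = 0 ∧ deriv f 0 = 0 ∧ iteratedDeriv 2 f 0 = 0 ∧
    iteratedDeriv 3 f 0 = μ * qg * iteratedDeriv 3 ve vc / (vc + vg) ∧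
    (iteratedDeriv 3 ve vc < 0 →
      0 < -(μ * qg * iteratedDeriv 3 ve vc) / (6 * (vc + vg))) := by
  have hne : vc + vg ≠ 0 := hpos.ne'
  have hve3 : ContDiffAt ℝ 3 ve vc := by
    rw [funext hve]
    exact hg.contDiffAt.comp vc
      (contDiffAt_const.div (contDiffAt_id.add contDiffAt_const) hne)
  have hshift : ContDiffAt ℝ 3 (fun u => ve (u + vc)) 0 :=
    ContDiffAt.comp (g := ve) 0 (by simpa using hve3) (contDiffAt_id.add contDiffAt_const)
  have hlin : ContDiffAt ℝ 3 (fun u : ℝ => u + vc) 0 := contDiffAt_id.add contDiffAt_const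
  have hnum : ContDiffAt ℝ 3 ((fun u => ve (u + vc)) - fun u => u + vc) 0 := hshift.sub hlin
  have hden : ContDiffAt ℝ 3 (fun u : ℝ => μ * qg / (u + vc + vg)) 0 :=
    contDiffAt_const.div (hlin.add contDiffAt_const) (by simpa using hne)
  have hfun : f = ((fun u => ve (u + vc)) - fun u => u + vc) *
      fun u : ℝ => μ * qg / (u + vc + vg) := by
    funext u
    simp only [hf, Pi.mul_apply, Pi.sub_apply]
    ring
  have hd_lin : deriv (fun u : ℝ => u + vc) = fun _ => 1 := by
    funext u
    simp
  have num0 : iteratedDeriv 0 ((fun u => ve (u + vc)) - fun u => u + vc) 0 = 0 := by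
    simp [heq]
  have num1 : iteratedDeriv 1 ((fun u => ve (u + vc)) - fun u => u + vc) 0 = 0 := by
    rw [iteratedDeriv_sub (hshift.of_le (by norm_num)) (hlin.of_le (by norm_num)),
      iteratedDeriv_comp_add_const]
    simp [iteratedDeriv_one, hd1]
  have num2 : iteratedDeriv 2 ((fun u => ve (u + vc)) - fun u => u + vc) 0 = 0 := by
    rw [iteratedDeriv_sub (hshift.of_le (by norm_num)) (hlin.of_le (by norm_num)),
      iteratedDeriv_comp_add_const, iteratedDeriv_succ' (f := fun u : ℝ => u + vc), hd_lin]
    simp [hd2, iteratedDeriv_const]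
  have num3 : iteratedDeriv 3 ((fun u => ve (u + vc)) - fun u => u + vc) 0 =
      iteratedDeriv 3 ve vc := by
    rw [iteratedDeriv_sub hshift hlin,
      iteratedDeriv_comp_add_const, iteratedDeriv_succ' (f := fun u : ℝ => u + vc), hd_lin]
    simp [iteratedDeriv_const]
  refine ⟨by simp [hf, heq], ?_, ?_, ?_, fun h => ?_⟩
  · rw [← iteratedDeriv_one, hfun,
      iteratedDeriv_mul (hnum.of_le (by norm_num)) (hden.of_le (by norm_num))]
    simp only [Finset.sum_range_succ, Finset.sum_range_zero, num0, num1]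
    ring
  · rw [hfun, iteratedDeriv_mul (hnum.of_le (by norm_num)) (hden.of_le (by norm_num))]
    simp only [Finset.sum_range_succ, Finset.sum_range_zero, num0, num1, num2]
    ring
  · rw [hfun, iteratedDeriv_mul hnum hden]
    simp only [Finset.sum_range_succ, Finset.sum_range_zero, num0, num1, num2, num3,
      Nat.choose_self, Nat.sub_self, iteratedDeriv_zero, zero_add]
    push_cast
    ring
  · have : μ * qg * iteratedDeriv 3 ve vc < 0 := mul_neg_of_pos_of_neg (mul_pos hμ hqg) h
    exact div_pos (neg_pos.mpr this) (by positivity)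
end
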